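/- f has a physical measure if and only if there exists a decreasing (under inclusion) sequence (𝒜_n)_{n≥1} of generalized attractors of f such that the sequence of diameters diam(𝒜_n) converges to zero and the sequence of attracting sizes m(B(𝒜_n)) converges to some α > 0. -/

import Mathlib

open MeasureTheory Filter Set Topology
open scoped ENNReal NNReal

/-- A metric on a topological space `P` (here: the space `𝒫` of Borel probability
measures with the weak* topology) inducing its topology; `d` plays the role of `dist*`. -/
structure CompatibleMetric (P : Type*) [TopologicalSpace P] where
  d : P → P → ℝ
  symm : ∀ x y, d x y = d y x
  triangle : ∀ x y z, d x z ≤ d x y + d y z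
  eq_iff_dist_eq_zero : ∀ x y, d x y = 0 ↔ x = y
  nhds_iff : ∀ (x : P) (s : Set P), s ∈ nhds x ↔ ∃ ε > 0, {y | d x y < ε} ⊆ s

/-- The diameter of a set of measures w.r.t. the metric `D.d`. -/
noncomputable def diamD {P : Type*} [TopologicalSpace P] (D : CompatibleMetric P)
    (A : Set P) : ℝ :=
  sSup (Set.image2 D.d A A)

variable {M : Type*} [MeasurableSpace M] [TopologicalSpace M] [OpensMeasurableSpace M]

/-- The empirical measure `σ_{n+1,x} = (1/(n+1)) ∑_{j=0}^{n} δ_{f^j(x)}`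
(index shifted so that it is defined for every `n : ℕ`). -/
noncomputable def empiric (f : M → M) (x : M) (n : ℕ) : ProbabilityMeasure M :=
  ⟨((n : ℝ≥0∞) + 1)⁻¹ • ∑ j ∈ Finset.range (n + 1), Measure.dirac (f^[j] x), by
    constructor
    rw [Measure.smul_apply, Measure.finset_sum_apply]
    simp only [measure_univ, Finset.sum_const, Finset.card_range, nsmul_eq_mul, mul_one,
      smul_eq_mul]
    rw [Nat.cast_add, Nat.cast_one]
    exact ENNReal.inv_mul_cancel (by simp)
      (ENNReal.add_ne_top.2 ⟨ENNReal.natCast_ne_top n, ENNReal.one_ne_top⟩)⟩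

/-- `pω(x)`: the set of weak* limit points of the sequence of empirical measures
of the orbit of `x`. -/
def pomega (f : M → M) (x : M) : Set (ProbabilityMeasure M) :=
  {μ | MapClusterPt μ atTop (empiric f x)}

/-- The basin of attraction `B(K) = {x : pω(x) ⊆ K}` of a set of probability measures. -/
def basin (f : M → M) (K : Set (ProbabilityMeasure M)) : Set M :=
  {x | pomega f x ⊆ K}

/-- `μ` is observable: for all `ε > 0` the `ε`-basin of partial attraction
`A_ε(μ) = {x : dist*(pω(x), μ) < ε}` has positive `m`-measure. -/
def Observable (D : CompatibleMetric (ProbabilityMeasure M)) (m : Measure M)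
    (f : M → M) (μ : ProbabilityMeasure M) : Prop :=
  ∀ ε > 0, 0 < m {x | ∃ ν ∈ pomega f x, D.d ν μ < ε}

/-- `μ` is a physical measure: its basin `{x : pω(x) = {μ}}` has positive `m`-measure. -/
def PhysicalMeasure (m : Measure M) (f : M → M) (μ : ProbabilityMeasure M) : Prop :=
  0 < m {x | pomega f x = {μ}}

/-- A generalized attractor (reduction of the set `𝒪` of observable measures): a nonempty
weak*-compact set of observable measures whose basin has positive `m`-measure. -/
def GenAttractor (D : CompatibleMetric (ProbabilityMeasure M)) (m : Measure M)
    (f : M → M) (A : Set (ProbabilityMeasure M)) : Prop :=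
  A.Nonempty ∧ IsCompact A ∧ (∀ μ ∈ A, Observable D m f μ) ∧ 0 < m (basin f A)

/-- Two generalized attractors are independent if the basin of their intersection is null. -/
def IndepGA (m : Measure M) (f : M → M) (A B : Set (ProbabilityMeasure M)) : Prop :=
  m (basin f (A ∩ B)) = 0

/-- A co-chain: an (at most countable) family of pairwise independent generalized attractors. -/
def IsCochain (D : CompatibleMetric (ProbabilityMeasure M)) (m : Measure M) (f : M → M)
    (S : Set (Set (ProbabilityMeasure M))) : Prop :=
  S.Countable ∧ (∀ A ∈ S, GenAttractor D m f A) ∧ S.Pairwise (IndepGA m f)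

/-- A chain: a (finite or countably infinite) sequence, indexed by `I ⊆ ℕ`, of generalized
attractors that is strictly decreasing under inclusion. -/
def IsChainGA (D : CompatibleMetric (ProbabilityMeasure M)) (m : Measure M) (f : M → M)
    (I : Set ℕ) (c : ℕ → Set (ProbabilityMeasure M)) : Prop :=
  I.Nonempty ∧ (∀ i ∈ I, GenAttractor D m f (c i)) ∧
    ∀ i ∈ I, ∀ j ∈ I, j < i → c i ⊂ c j

/-- Two chains are independent if each contains a member independent of some member
of the other. -/
def IndepChainPair (m : Measure M) (f : M → M)
    (p q : Set ℕ × (ℕ → Set (ProbabilityMeasure M))) : Prop :=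
  (∃ i ∈ p.1, ∃ j ∈ q.1, IndepGA m f (p.2 i) (q.2 j)) ∧
    (∃ j ∈ q.1, ∃ i ∈ p.1, IndepGA m f (q.2 j) (p.2 i))

/-- `k`: the supremum of the lengths (cardinalities) of co-chains of generalized attractors. -/
noncomputable def cochainSup (D : CompatibleMetric (ProbabilityMeasure M)) (m : Measure M)
    (f : M → M) : Cardinal :=
  sSup {c : Cardinal | ∃ S, IsCochain D m f S ∧ c = Cardinal.mk S}

/-- `h`: the supremum of the cardinalities of (at most countable) families of pairwise
independent chains of generalized attractors. -/
noncomputable def indepChainFamilySup (D : CompatibleMetric (ProbabilityMeasure M))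
    (m : Measure M) (f : M → M) : Cardinal :=
  sSup {c : Cardinal | ∃ F : Set (Set ℕ × (ℕ → Set (ProbabilityMeasure M))),
    F.Countable ∧ (∀ p ∈ F, IsChainGA D m f p.1 p.2) ∧ F.Pairwise (IndepChainPair m f) ∧
    c = Cardinal.mk F}

/-- An irreducible generalized attractor: one containing no proper compact subset that is
itself a generalized attractor. -/
def IrreducibleGA (D : CompatibleMetric (ProbabilityMeasure M)) (m : Measure M) (f : M → M)
    (A : Set (ProbabilityMeasure M)) : Prop :=
  GenAttractor D m f A ∧ ∀ K, IsCompact K → K ⊂ A → ¬ GenAttractor D m f K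

/-- In a compact metric space, all cluster points of a sequence lie in a nonempty closed set `K`
iff the distance to `K` tends to zero along the sequence. -/
theorem forall_mapClusterPt_mem_iff_tendsto_infDist {P : Type*} [MetricSpace P] [CompactSpace P]
    {K : Set P} (hK : IsClosed K) (hne : K.Nonempty) (u : ℕ → P) :
    {p | MapClusterPt p atTop u} ⊆ K ↔
      Tendsto (fun n => Metric.infDist (u n) K) atTop (𝓝 0) := by
  constructor
  · intro h
    refine (tendsto_order.2 ⟨fun a ha => Eventually.of_forall fun n =>
      ha.trans_le Metric.infDist_nonneg, fun ε hε => ?_⟩)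
    by_contra hev
    have hfreq : ∃ᶠ n in atTop, u n ∈ {p | ε ≤ Metric.infDist p K} := by
      simpa [Filter.Frequently] using hev
    obtain ⟨p, hp, hc⟩ := (isClosed_le continuous_const
      (Metric.continuous_infDist_pt K)).isCompact.exists_mapClusterPt_of_frequently hfreq
    have hp' : ε ≤ Metric.infDist p K := hp
    rw [Metric.infDist_zero_of_mem (h hc)] at hp'
    exact absurd hε hp'.not_gt
  · intro h p (hp : MapClusterPt p atTop u)
    have hc : MapClusterPt (Metric.infDist p K) atTop ((fun q => Metric.infDist q K) ∘ u) :=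
      hp.tendsto_comp ((Metric.continuous_infDist_pt K).tendsto p)
    have h0 : Metric.infDist p K = 0 :=
      eq_of_nhds_neBot (ClusterPt.mono hc h).neBot
    exact (hK.mem_iff_infDist_zero hne).2 h0

namespace CompatibleMetric

variable {P : Type*} [TopologicalSpace P] (D : CompatibleMetric P)

theorem d_self (x : P) : D.d x x = 0 := (D.eq_iff_dist_eq_zero x x).2 rfl

theorem d_nonneg (x y : P) : 0 ≤ D.d x y := by
  have h := D.triangle x y x
  rw [D.d_self, D.symm y x] at h
  linarith

theorem isOpen_setOf_d_lt (x : P) (r : ℝ) : IsOpen {y | D.d x y < r} := by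
  refine isOpen_iff_mem_nhds.2 fun y hy => (D.nhds_iff y _).2 ⟨r - D.d x y, sub_pos.2 hy, ?_⟩
  intro z hz
  have h := D.triangle x y z
  simp only [mem_ofPred_eq] at hz ⊢
  linarith

theorem bddAbove_image2_d {A : Set P} (hA : IsCompact A) : BddAbove (image2 D.d A A) := by
  rcases A.eq_empty_or_nonempty with rfl | ⟨a, ha⟩
  · simp
  obtain ⟨n, hn⟩ := hA.elim_directed_cover (fun n : ℕ => {y | D.d a y < n})
    (fun n => D.isOpen_setOf_d_lt a n)
    (fun y _ => mem_iUnion.2 (exists_nat_gt (D.d a y)))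
    (Monotone.directed_le fun i j hij y (hy : D.d a y < i) =>
      hy.trans_le (Nat.cast_le.2 hij))
  refine ⟨n + n, ?_⟩
  rintro _ ⟨x, hx, y, hy, rfl⟩
  have h1 : D.d a x < n := hn hx
  have h2 : D.d a y < n := hn hy
  have h3 := D.triangle x a y
  rw [D.symm x a] at h3
  linarith

theorem d_le_diamD {A : Set P} (hA : IsCompact A) {x y : P} (hx : x ∈ A) (hy : y ∈ A) :
    D.d x y ≤ diamD D A :=
  le_csSup (D.bddAbove_image2_d hA) (mem_image2_of_mem hx hy)

theorem diamD_singleton (x : P) : diamD D {x} = 0 := by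
  simp [diamD, D.d_self]

/-- A decreasing sequence of nonempty compact sets with diameters tending to zero shrinks to a
point. -/
theorem exists_iInter_eq_singleton [T2Space P] {A : ℕ → Set P} (hne : ∀ n, (A n).Nonempty)
    (hc : ∀ n, IsCompact (A n)) (hA : Antitone A)
    (hdiam : Tendsto (fun n => diamD D (A n)) atTop (𝓝 0)) : ∃ x, ⋂ n, A n = {x} := by
  obtain ⟨x, hx⟩ := IsCompact.nonempty_iInter_of_sequence_nonempty_isCompact_isClosed A
    (fun n => hA n.le_succ) hne (hc 0) (fun n => (hc n).isClosed)
  refine ⟨x, subset_antisymm (fun y hy => ?_) (singleton_subset_iff.2 hx)⟩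
  have h : D.d y x ≤ 0 := ge_of_tendsto' hdiam fun n =>
    D.d_le_diamD (hc n) (mem_iInter.1 hy n) (mem_iInter.1 hx n)
  exact (D.eq_iff_dist_eq_zero y x).1 (h.antisymm (D.d_nonneg y x))

end CompatibleMetric

theorem integral_empiric {Y : Type*} [MeasurableSpace Y] {f : Y → Y} (x : Y) (n : ℕ)
    {g : Y → ℝ} (hg : StronglyMeasurable g) :
    ∫ y, g y ∂(empiric f x n : Measure Y) =
      ((n : ℝ) + 1)⁻¹ * ∑ j ∈ Finset.range (n + 1), g (f^[j] x) := by
  have h : (empiric f x n : Measure Y) = ((n : ℝ≥0∞) + 1)⁻¹ •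
    ∑ j ∈ Finset.range (n + 1), Measure.dirac (f^[j] x) := rfl
  rw [h, integral_smul_measure, integral_finsetSum_measure]
  · simp only [integral_dirac' g _ hg, smul_eq_mul, ENNReal.toReal_inv]
    congr 2
  · exact fun j _ => integrable_dirac' hg enorm_lt_top

theorem basin_iInter {ι : Type*} (f : M → M) (A : ι → Set (ProbabilityMeasure M)) :
    basin f (⋂ i, A i) = ⋂ i, basin f (A i) := by
  ext x
  simp [basin, subset_iInter_iff]

theorem basin_mono (f : M → M) {A B : Set (ProbabilityMeasure M)} (h : A ⊆ B) :
    basin f A ⊆ basin f B :=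
  fun _ hx => Subset.trans hx h

section Compact

variable {X : Type*} [MetricSpace X] [MeasurableSpace X] [BorelSpace X]

theorem continuous_empiric {f : X → X} (hf : Continuous f) (n : ℕ) :
    Continuous fun x => empiric f x n := by
  refine ProbabilityMeasure.continuous_iff_forall_continuous_integral.2 fun g => ?_
  simp only [integral_empiric _ _ g.continuous.stronglyMeasurable]
  exact continuous_const.mul (continuous_finsetSum _ fun j _ =>
    g.continuous.comp (hf.iterate j))

variable [CompactSpace X]

theorem pomega_nonempty (f : X → X) (x : X) : (pomega f x).Nonempty :=
  exists_clusterPt_of_compactSpace _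

theorem measurableSet_basin {f : X → X} (hf : Continuous f) {K : Set (ProbabilityMeasure X)}
    (hK : IsClosed K) : MeasurableSet (basin f K) := by
  let _ : MetricSpace (ProbabilityMeasure X) :=
    TopologicalSpace.metrizableSpaceMetric (ProbabilityMeasure X)
  rcases K.eq_empty_or_nonempty with rfl | hne
  · have h : basin f (∅ : Set (ProbabilityMeasure X)) = ∅ :=
      eq_empty_of_forall_notMem fun x hx => (pomega_nonempty f x).not_subset_empty hx
    rw [h]
    exact MeasurableSet.empty
  · have h : basin f K =
        {x | Tendsto (fun n => Metric.infDist (empiric f x n) K) atTop (𝓝 0)} := by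
      ext x
      exact forall_mapClusterPt_mem_iff_tendsto_infDist hK hne _
    rw [h]
    exact measurableSet_tendsto _ fun n =>
      ((Metric.continuous_infDist_pt K).comp (continuous_empiric hf n)).measurable

theorem basin_singleton (f : X → X) (μ : ProbabilityMeasure X) :
    basin f {μ} = {x | pomega f x = {μ}} := by
  ext x
  exact (pomega_nonempty f x).subset_singleton_iff

end Compact

theorem PhysicalMeasure.genAttractor_singleton (D : CompatibleMetric (ProbabilityMeasure M))
    {m : Measure M} {f : M → M} {μ : ProbabilityMeasure M} (h : PhysicalMeasure m f μ) :
    GenAttractor D m f {μ} := by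
  refine ⟨singleton_nonempty μ, isCompact_singleton, ?_, ?_⟩
  · rintro _ rfl ε hε
    refine h.trans_le (measure_mono fun x hx => ⟨_, ?_, (D.d_self _).trans_lt hε⟩)
    rw [hx]
    exact mem_singleton _
  · exact h.trans_le (measure_mono fun x hx => Eq.subset hx)

/-- Physical measures and chains: `f` has a physical measure iff there is a decreasing
sequence of generalized attractors whose diameters tend to `0` and whose attracting sizes
tend to some `α > 0`. -/
theorem physical_iff_chain {M : Type*} [MetricSpace M] [CompactSpace M] [MeasurableSpace M] [BorelSpace M]
    (D : CompatibleMetric (ProbabilityMeasure M))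
    (m : Measure M) [IsProbabilityMeasure m]
    (f : M → M) (hf : Continuous f) :
    (∃ μ : ProbabilityMeasure M, PhysicalMeasure m f μ) ↔
      ∃ A : ℕ → Set (ProbabilityMeasure M),
        (∀ n, GenAttractor D m f (A n)) ∧
        (∀ i j, i ≤ j → A j ⊆ A i) ∧
        Tendsto (fun n => diamD D (A n)) atTop (nhds 0) ∧
        ∃ α : ℝ≥0∞, 0 < α ∧ Tendsto (fun n => m (basin f (A n))) atTop (nhds α) := by
  constructor
  · rintro ⟨μ, hμ⟩
    have h := hμ.genAttractor_singleton D
    refine ⟨fun _ => {μ}, fun _ => h, fun _ _ _ => Subset.rfl, ?_, _, h.2.2.2, tendsto_const_nhds⟩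
    simp only [D.diamD_singleton]
    exact tendsto_const_nhds
  · rintro ⟨A, hA, hanti, hdiam, α, hα, hlim⟩
    obtain ⟨μ, hμ⟩ := D.exists_iInter_eq_singleton (fun n => (hA n).1) (fun n => (hA n).2.1)
      hanti hdiam
    refine ⟨μ, ?_⟩
    have h : Tendsto (fun n => m (basin f (A n))) atTop (𝓝 (m (⋂ n, basin f (A n)))) :=
      tendsto_measure_iInter_atTop
        (fun n => (measurableSet_basin hf (hA n).2.1.isClosed).nullMeasurableSet)
        (fun i j hij => basin_mono f (hanti i j hij)) ⟨0, measure_ne_top _ _⟩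
    rw [← basin_iInter, hμ, basin_singleton] at h
    exact hα.trans_eq (tendsto_nhds_unique hlim h)
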